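/- For every integer n ≥ 2 and all indices with 1 ≤ j ≤ i ≤ n−1, 1 ≤ l ≤ k ≤ n−1, j+2 ≤ k, i < k and j ≥ l, the equation h^{[i,j]} h^{[k,l]} = h^{[i,l]} h^{[k,j+2]} holds in the Kauffman monoid K_n. -/

import Mathlib

/-!
Kauffman monoid `K n` for `n ≥ 2`: presented by generators `h^1, …, h^{n-1}`
(diapsides) and `c` (circle), subject to
`h^i h^j = h^j h^i` for `|i-j| ≥ 2`, `h^i h^{i±1} h^i = h^i`,
`h^i c = c h^i`, `h^i h^i = c h^i`.
-/

namespace Kauffman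

/-- Valid diapsis indices `1 ≤ i ≤ n-1`. -/
def Idx (n : ℕ) : Type := {i : ℕ // 1 ≤ i ∧ i ≤ n - 1}

/-- Generators of the Kauffman monoid. -/
inductive Gen (n : ℕ) : Type
  | h : Idx n → Gen n
  | c : Gen n

/-- The defining relations of the Kauffman monoid. -/
inductive Rel (n : ℕ) : FreeMonoid (Gen n) → FreeMonoid (Gen n) → Prop
  | comm (i j : Idx n) (hij : i.1 + 2 ≤ j.1 ∨ j.1 + 2 ≤ i.1) :
      Rel n (FreeMonoid.of (Gen.h i) * FreeMonoid.of (Gen.h j))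
            (FreeMonoid.of (Gen.h j) * FreeMonoid.of (Gen.h i))
  | absorb (i j : Idx n) (hij : j.1 = i.1 + 1 ∨ i.1 = j.1 + 1) :
      Rel n (FreeMonoid.of (Gen.h i) * FreeMonoid.of (Gen.h j) * FreeMonoid.of (Gen.h i))
            (FreeMonoid.of (Gen.h i))
  | hc (i : Idx n) :
      Rel n (FreeMonoid.of (Gen.h i) * FreeMonoid.of Gen.c)
            (FreeMonoid.of Gen.c * FreeMonoid.of (Gen.h i))
  | hh (i : Idx n) :
      Rel n (FreeMonoid.of (Gen.h i) * FreeMonoid.of (Gen.h i))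
            (FreeMonoid.of Gen.c * FreeMonoid.of (Gen.h i))

/-- The congruence generated by the Kauffman relations. -/
def kcon (n : ℕ) : Con (FreeMonoid (Gen n)) := conGen (Rel n)

/-- The Kauffman monoid `K n`. -/
abbrev K (n : ℕ) : Type := (kcon n).Quotient

/-- The diapsis `h^i` as an element of `K n` (defined to be `1` for out-of-range `i`). -/
def hK (n i : ℕ) : K n :=
  if h : 1 ≤ i ∧ i ≤ n - 1 then ((FreeMonoid.of (Gen.h ⟨i, h⟩) : FreeMonoid (Gen n)) : K n)
  else 1

/-- The circle `c` as an element of `K n`. -/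
def cK (n : ℕ) : K n := ((FreeMonoid.of Gen.c : FreeMonoid (Gen n)) : K n)

/-- The block `h^{[i,j]} = h^i h^{i-1} ⋯ h^{j+1} h^j` (for `j ≤ i`). -/
def block (n i j : ℕ) : K n :=
  (((List.range (i + 1 - j)).map fun t => hK n (i - t))).prod

end Kauffman

namespace Kauffman

theorem hK_commute (n : ℕ) {a b : ℕ} (hab : a + 2 ≤ b) : Commute (hK n a) (hK n b) := by
  unfold hK
  split_ifs with ha hb
  · exact (Con.eq (kcon n)).2 (ConGen.Rel.of _ _ (Rel.comm ⟨a, ha⟩ ⟨b, hb⟩ (Or.inl hab)))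
  · exact Commute.one_right _
  · exact Commute.one_left _
  · exact Commute.one_left _

theorem hK_absorb_succ {n j : ℕ} (hj : 1 ≤ j) (hjn : j + 1 ≤ n - 1) :
    hK n j * hK n (j + 1) * hK n j = hK n j := by
  have h₁ : 1 ≤ j ∧ j ≤ n - 1 := ⟨hj, by omega⟩
  have h₂ : 1 ≤ j + 1 ∧ j + 1 ≤ n - 1 := ⟨by omega, hjn⟩
  rw [hK, dif_pos h₁, hK, dif_pos h₂]
  exact (Con.eq (kcon n)).2 (ConGen.Rel.of _ _ (Rel.absorb ⟨j, h₁⟩ ⟨j + 1, h₂⟩ (Or.inl rfl)))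

theorem block_self (n i : ℕ) : block n i i = hK n i := by
  simp [block]

theorem block_eq_mul (n : ℕ) {i m l : ℕ} (hmi : m ≤ i) (hlm : l ≤ m + 1) :
    block n i l = block n i (m + 1) * block n m l := by
  have hlen : i + 1 - l = (i + 1 - (m + 1)) + (m + 1 - l) := by omega
  unfold block
  rw [hlen, List.range_add, List.map_append, List.prod_append, List.map_map]
  congr 3
  funext t
  simp only [Function.comp_apply]
  congr 1
  omega

theorem commute_block {n i j : ℕ} {x : K n}
    (h : ∀ a, j ≤ a → a ≤ i → Commute x (hK n a)) : Commute x (block n i j) := by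
  refine Commute.list_prod_right _ _ fun y hy => ?_
  obtain ⟨t, ht, rfl⟩ := List.mem_map.1 hy
  rw [List.mem_range] at ht
  exact h _ (by omega) (by omega)

theorem block_commute_block (n : ℕ) {i j k l : ℕ} (h : i + 2 ≤ l) :
    Commute (block n i j) (block n k l) :=
  commute_block fun _ hb _ =>
    (commute_block fun _ _ ha => (hK_commute n (by omega)).symm).symm

theorem hK_mul_block {n j k l : ℕ} (hj : 1 ≤ j) (hjk : j + 2 ≤ k) (hk : k ≤ n - 1)
    (hlj : l ≤ j) : hK n j * block n k l = block n j l * block n k (j + 2) := by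
  have hcomm : Commute (hK n j) (block n k (j + 2)) :=
    commute_block fun _ ha _ => hK_commute n ha
  have hself : hK n j * hK n (j + 1) * block n j l = block n j l := by
    rcases hlj.eq_or_lt with rfl | hlt
    · rw [block_self, hK_absorb_succ hj (by omega)]
    · obtain ⟨m, rfl⟩ : ∃ m, j = m + 1 := ⟨j - 1, by omega⟩
      rw [block_eq_mul n (Nat.le_succ m) (by omega : l ≤ m + 1), block_self, ← mul_assoc,
        hK_absorb_succ hj (by omega)]
  rw [block_eq_mul n (by omega : j + 1 ≤ k) (by omega : l ≤ j + 1 + 1),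
    block_eq_mul n (Nat.le_succ j) (by omega : l ≤ j + 1), block_self, ← mul_assoc, hcomm.eq,
    mul_assoc, ← mul_assoc (hK n j), hself, (block_commute_block n le_rfl).eq]

end Kauffman

open Kauffman in
/-- `(h III.2)`: for `j+2 ≤ k`, `i < k` and `j ≥ l`,
`h^{[i,j]} h^{[k,l]} = h^{[i,l]} h^{[k,j+2]}` in `K n`. -/
theorem kauffman_block_exchange_two (n i j k l : ℕ) (hn : 2 ≤ n)
    (hj : 1 ≤ j) (hji : j ≤ i) (hi : i ≤ n - 1)
    (hl : 1 ≤ l) (hlk : l ≤ k) (hk : k ≤ n - 1)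
    (hjk : j + 2 ≤ k) (hik : i < k) (hjl : l ≤ j) :
    block n i j * block n k l = block n i l * block n k (j + 2) := by
  rw [block_eq_mul n hji (Nat.le_succ j), block_self, mul_assoc, hK_mul_block hj hjk hk hjl,
    ← mul_assoc, ← block_eq_mul n hji (by omega)]
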